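/- Let V be one of the Lie superalgebras W(m,n), W(m,n) ⋉ A d_0, or W(m+1,n), and suppose M is a simple strong Harish-Chandra V-module. Then the action of h'' on M is diagonalizable, and M is a Harish-Chandra module (i.e., has a weight decomposition with respect to h with finite-dimensional weight spaces). -/

import Mathlib

open scoped BigOperators

namespace WSuper

noncomputable section

/-- Exponents of the Laurent (even) variables `t_1, …, t_m`. -/
abbrev LExp (m : ℕ) := Fin m → ℤ
/-- Exponents of the Grassmann (odd) variables `ξ_1, …, ξ_n`. -/
abbrev GExp (n : ℕ) := Fin n → Bool

variable {m n : ℕ}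

/-- Degree of a Grassmann monomial `ξ^s`. -/
def gdeg (s : GExp n) : ℕ := (Finset.univ.filter fun a => s a = true).card

/-- Number of inversions between `ξ^s` and `ξ^q`. -/
def invCount (s q : GExp n) : ℕ :=
  ((Finset.univ ×ˢ Finset.univ).filter
    fun p : Fin n × Fin n => s p.1 = true ∧ q p.2 = true ∧ p.2 < p.1).card

/-- The scalar `c` with `ξ^s · ξ^q = c · ξ^(s xor q)` in the exterior algebra. -/
def mulSgn (s q : GExp n) : ℂ :=
  if ∃ a, s a = true ∧ q a = true then 0 else (-1 : ℂ) ^ invCount s q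

/-- Exponent of the product of two (disjoint) Grassmann monomials. -/
def xorE (s q : GExp n) : GExp n := fun a => Bool.xor (s a) (q a)

/-- The scalar `c` with `∂_a (ξ^s) = c ξ^(s \ a)`. -/
def derC (a : Fin n) (s : GExp n) : ℂ :=
  if s a = true then (-1 : ℂ) ^ (Finset.univ.filter fun x => s x = true ∧ x < a).card else 0

/-- The exponent of `∂_a (ξ^s)`. -/
def derE (a : Fin n) (s : GExp n) : GExp n := Function.update s a false

/-- Directions: `d_i = t_i ∂/∂t_i`, `∂_α = ∂/∂ξ_α`, and (when `b = true`) the extra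
even direction `d_0` of `W(m,n) ⋉ A d_0`. -/
inductive Dir (m n : ℕ) : Bool → Type where
  | di {b : Bool} (i : Fin m) : Dir m n b
  | pa {b : Bool} (a : Fin n) : Dir m n b
  | d0 : Dir m n true

/-- The basis `t^r ξ^s D` of `W(m,n)` (for `b = false`) resp. of `W(m,n) ⋉ A d_0`
(for `b = true`). -/
abbrev WBasis (m n : ℕ) (b : Bool) := LExp m × GExp n × Dir m n b

/-- The Lie superalgebra `W(m,n)` (`b = false`) resp. `W(m,n) ⋉ A d_0` (`b = true`),
as the free complex vector space on its standard basis. -/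
abbrev W (m n : ℕ) (b : Bool) := WBasis m n b →₀ ℂ

def sng {b : Bool} (x : WBasis m n b) : W m n b := Finsupp.single x 1

/-- Parity (0 = even, 1 = odd) of a basis element. -/
def par {b : Bool} : WBasis m n b → ℕ
  | ⟨_, s, .di _⟩ => gdeg s % 2
  | ⟨_, s, .pa _⟩ => (gdeg s + 1) % 2
  | ⟨_, s, .d0⟩ => gdeg s % 2

/-- The super Lie bracket of `W(m,n)` (resp. `W(m,n) ⋉ A d_0`) on basis elements. -/
def brB {b : Bool} : WBasis m n b → WBasis m n b → W m n b
  | ⟨r, s, .di i⟩, ⟨p, q, .di j⟩ =>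
      ((p i : ℂ) * mulSgn s q) • sng ⟨r + p, xorE s q, .di j⟩
        - ((r j : ℂ) * mulSgn s q) • sng ⟨r + p, xorE s q, .di i⟩
  | ⟨r, s, .di i⟩, ⟨p, q, .pa β⟩ =>
      ((p i : ℂ) * mulSgn s q) • sng ⟨r + p, xorE s q, .pa β⟩
        - ((-1 : ℂ) ^ (gdeg s * (gdeg q + 1)) * derC β s * mulSgn q (derE β s)) •
            sng ⟨r + p, xorE q (derE β s), .di i⟩
  | ⟨r, s, .pa α⟩, ⟨p, q, .di j⟩ =>
      (derC α q * mulSgn s (derE α q)) • sng ⟨r + p, xorE s (derE α q), .di j⟩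
        - ((-1 : ℂ) ^ ((gdeg s + 1) * gdeg q) * (r j : ℂ) * mulSgn q s) •
            sng ⟨r + p, xorE q s, .pa α⟩
  | ⟨r, s, .pa α⟩, ⟨p, q, .pa β⟩ =>
      (derC α q * mulSgn s (derE α q)) • sng ⟨r + p, xorE s (derE α q), .pa β⟩
        - ((-1 : ℂ) ^ ((gdeg s + 1) * (gdeg q + 1)) * derC β s * mulSgn q (derE β s)) •
            sng ⟨r + p, xorE q (derE β s), .pa α⟩
  | ⟨r, s, .di i⟩, ⟨p, q, .d0⟩ =>
      ((p i : ℂ) * mulSgn s q) • sng ⟨r + p, xorE s q, .d0⟩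
  | ⟨r, s, .pa α⟩, ⟨p, q, .d0⟩ =>
      (derC α q * mulSgn s (derE α q)) • sng ⟨r + p, xorE s (derE α q), .d0⟩
  | ⟨r, s, .d0⟩, ⟨p, q, .di j⟩ =>
      (-(r j : ℂ) * mulSgn s q) • sng ⟨r + p, xorE s q, .d0⟩
  | ⟨r, s, .d0⟩, ⟨p, q, .pa β⟩ =>
      (-(-1 : ℂ) ^ (gdeg s * (gdeg q + 1)) * derC β s * mulSgn q (derE β s)) •
          sng ⟨r + p, xorE q (derE β s), .d0⟩
  | ⟨_, _, .d0⟩, ⟨_, _, .d0⟩ => 0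

/-- A module over the Lie superalgebra `W(m,n)` (resp. `W(m,n) ⋉ A d_0`):
a complex vector space with a linear action satisfying the super commutator rule. -/
structure WRep (m n : ℕ) (b : Bool) where
  M : Type
  [addgrp : AddCommGroup M]
  [mods : Module ℂ M]
  act : W m n b →ₗ[ℂ] M →ₗ[ℂ] M
  super : ∀ x y : WBasis m n b,
    act (brB x y)
      = act (sng x) ∘ₗ act (sng y)
        - ((-1 : ℂ) ^ (par x * par y)) • (act (sng y) ∘ₗ act (sng x))

attribute [instance] WRep.addgrp WRep.mods

/-- A raw action of (the basis of) `W(m,n)` resp. `W(m,n) ⋉ A d_0` on a vector space. -/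
abbrev GAct (m n : ℕ) (b : Bool) (M : Type) [AddCommGroup M] [Module ℂ M] :=
  WBasis m n b → M →ₗ[ℂ] M

/-- Index set for the Cartan subalgebra `h'`: the elements `d_1, …, d_m`,
together with `d_0` when `b = true`. -/
abbrev HIdx (m : ℕ) (b : Bool) := Fin m ⊕ Fin (cond b 1 0)

def hB (m n : ℕ) (b : Bool) : HIdx m b → WBasis m n b :=
  fun h => match b, h with
    | _, .inl i => ⟨0, fun _ => false, .di i⟩
    | true, .inr _ => ⟨0, fun _ => false, .d0⟩
    | false, .inr j => j.elim0

/-- The basis element `ξ_a ∂_a` of the odd Cartan subalgebra `h''`. -/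
def hppB (m n : ℕ) (b : Bool) (a : Fin n) : WBasis m n b :=
  ⟨0, fun x => decide (x = a), .pa a⟩

section Predicates

variable {M : Type} [AddCommGroup M] [Module ℂ M] {b : Bool}

/-- Weight space with respect to the even Cartan subalgebra `h'`. -/
def wtG (F : GAct m n b M) (lam : HIdx m b → ℂ) : Submodule ℂ M :=
  ⨅ h, LinearMap.ker (F (hB m n b h) - lam h • (LinearMap.id : M →ₗ[ℂ] M))

/-- Weight space with respect to the full Cartan subalgebra `h = h' ⊕ h''`. -/
def wtFullG (F : GAct m n b M) (lam : HIdx m b → ℂ) (mu : Fin n → ℂ) : Submodule ℂ M :=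
  wtG F lam ⊓
    ⨅ a, LinearMap.ker (F (hppB m n b a) - mu a • (LinearMap.id : M →ₗ[ℂ] M))

/-- Strong Harish-Chandra module: weight decomposition with respect to `h'`
with finite-dimensional weight spaces. -/
def IsStrongHCG (F : GAct m n b M) : Prop :=
  (⨆ lam, wtG F lam) = ⊤ ∧ ∀ lam, FiniteDimensional ℂ (wtG F lam)

/-- Harish-Chandra module: weight decomposition with respect to `h`
with finite-dimensional weight spaces. -/
def IsHCG (F : GAct m n b M) : Prop :=
  (⨆ lam, ⨆ mu, wtFullG F lam mu) = ⊤ ∧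
    ∀ lam mu, FiniteDimensional ℂ (wtFullG F lam mu)

/-- Strongly cuspidal: strong Harish-Chandra with uniformly bounded multiplicities. -/
def IsStronglyCuspidalG (F : GAct m n b M) : Prop :=
  IsStrongHCG F ∧ ∃ C : ℕ, ∀ lam, Module.finrank ℂ (wtG F lam) ≤ C

/-- Cuspidal: Harish-Chandra with uniformly bounded weight multiplicities. -/
def IsCuspidalG (F : GAct m n b M) : Prop :=
  IsHCG F ∧ ∃ C : ℕ, ∀ lam mu, Module.finrank ℂ (wtFullG F lam mu) ≤ C

/-- The action of the odd Cartan subalgebra `h''` is diagonalizable. -/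
def DiagHppG (F : GAct m n b M) : Prop :=
  (⨆ mu : Fin n → ℂ,
    ⨅ a, LinearMap.ker (F (hppB m n b a) - mu a • (LinearMap.id : M →ₗ[ℂ] M))) = ⊤

def InvariantG (F : GAct m n b M) (N : Submodule ℂ M) : Prop :=
  ∀ x : WBasis m n b, ∀ v ∈ N, F x v ∈ N

/-- Simplicity of a module, phrased via invariant subspaces. -/
def IsSimpleG (F : GAct m n b M) : Prop :=
  (∃ v : M, v ≠ 0) ∧ ∀ N : Submodule ℂ M, InvariantG F N → N = ⊥ ∨ N = ⊤

end Predicates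

/-- The action of basis elements attached to a representation. -/
def WRep.g {b : Bool} (ρ : WRep m n b) : GAct m n b ρ.M := fun x => ρ.act (sng x)

end

end WSuper

namespace WSuper

section HelperLemmas

variable {m n : ℕ}

lemma xorE_false_left (q : GExp n) : xorE (fun _ => false) q = q := by
  funext x; simp [xorE]

lemma xorE_false_right (q : GExp n) : xorE q (fun _ => false) = q := by
  funext x; simp [xorE]

lemma derC_false (a : Fin n) : derC a (fun _ : Fin n => false) = 0 := by
  simp [derC]

lemma derC_decide_of_ne {a c : Fin n} (h : c ≠ a) :
    derC c (fun x : Fin n => decide (x = a)) = 0 := by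
  simp [derC, h]

lemma derE_decide_self (a : Fin n) :
    derE a (fun x : Fin n => decide (x = a)) = fun _ => false := by
  funext x
  by_cases h : x = a <;> simp [derE, h]

lemma xorE_derE_of_mem {a : Fin n} {q : GExp n} (h : q a = true) :
    xorE (fun x => decide (x = a)) (derE a q) = q := by
  funext x
  by_cases hx : x = a
  · subst hx; simp [xorE, derE, h]
  · simp [xorE, derE, hx]

lemma gdeg_false : gdeg (fun _ : Fin n => false) = 0 := by
  simp [gdeg]

lemma gdeg_decide (a : Fin n) : gdeg (fun x : Fin n => decide (x = a)) = 1 := by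
  simp [gdeg, Finset.filter_eq']

lemma par_hppB {b : Bool} (a : Fin n) : par (hppB m n b a) = 0 := by
  simp [par, hppB, gdeg_decide]

lemma par_hB {b : Bool} (h : HIdx m b) : par (hB m n b h) = 0 := by
  rcases b with _ | _ <;> rcases h with i | i <;> first | exact i.elim0 | simp [par, hB, gdeg_false]

lemma exists_brB_hppB_eq_smul {b : Bool} (a : Fin n) (x : WBasis m n b) :
    ∃ c : ℂ, brB (hppB m n b a) x = c • sng x := by
  obtain ⟨p, q, d⟩ := x
  have key : ∀ d : Dir m n b, ∃ c : ℂ,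
      (derC a q * mulSgn (fun x => decide (x = a)) (derE a q)) •
        (sng ⟨p, xorE (fun x => decide (x = a)) (derE a q), d⟩ : W m n b)
          = c • sng ⟨p, q, d⟩ := by
    intro d
    by_cases hq : q a = true
    · exact ⟨_, by rw [xorE_derE_of_mem hq]⟩
    · exact ⟨0, by simp [derC, hq]⟩
  obtain ⟨c, hc⟩ := key d
  cases d with
  | di j => exact ⟨c, by simp [brB, hppB, ← hc]⟩
  | d0 => exact ⟨c, by simp [brB, hppB, ← hc]⟩
  | pa β =>
    by_cases hβ : β = a
    · subst hβ
      simp only [brB, hppB, hc, derE_decide_self, xorE_false_right, zero_add]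
      exact ⟨_, (sub_smul ..).symm⟩
    · exact ⟨c, by simp [brB, hppB, ← hc, derC_decide_of_ne hβ]⟩

lemma exists_brB_hB_eq_smul {b : Bool} (h : HIdx m b) (x : WBasis m n b) :
    ∃ c : ℂ, brB (hB m n b h) x = c • sng x := by
  obtain ⟨p, q, d⟩ := x
  rcases b with _ | _ <;> rcases h with i | i
  · cases d <;> simp only [brB, hB, xorE_false_left, derC_false, zero_add, Pi.zero_apply,
      Int.cast_zero, zero_mul, mul_zero, zero_smul, sub_zero] <;> exact ⟨_, rfl⟩
  · exact i.elim0
  · cases d <;> simp only [brB, hB, xorE_false_left, derC_false, zero_add, Pi.zero_apply,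
      Int.cast_zero, zero_mul, mul_zero, zero_smul, sub_zero] <;> exact ⟨_, rfl⟩
  · exact ⟨0, by cases d <;> simp [brB, hB, derC_false]⟩

lemma brB_hppB_hB {b : Bool} (a : Fin n) (h : HIdx m b) :
    brB (hppB m n b a) (hB m n b h) = 0 := by
  rcases b with _ | _ <;> rcases h with i | i <;>
    first | exact i.elim0 | simp [brB, hB, hppB, derC_false]

lemma brB_hppB_hppB {b : Bool} (a c : Fin n) :
    brB (hppB m n b a) (hppB m n b c) = 0 := by
  by_cases h : c = a
  · subst h; norm_num [brB, hppB, gdeg_decide]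
  · simp [brB, hppB, derC_decide_of_ne h, derC_decide_of_ne (Ne.symm h)]

lemma WRep.commutator_of_par_eq_zero {b : Bool} (ρ : WRep m n b) {h x : WBasis m n b} {c : ℂ}
    (hpar : par h = 0) (hbr : brB h x = c • sng x) (v : ρ.M) :
    ρ.g h (ρ.g x v) = ρ.g x (ρ.g h v) + c • ρ.g x v := by
  have := LinearMap.congr_fun (ρ.super h x) v
  simp only [hbr, hpar, zero_mul, pow_zero, one_smul, map_smul, LinearMap.smul_apply,
    LinearMap.sub_apply, LinearMap.comp_apply] at this
  simp only [WRep.g, this]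
  abel

lemma WRep.commute_of_par_eq_zero {b : Bool} (ρ : WRep m n b) {h x : WBasis m n b}
    (hpar : par h = 0) (hbr : brB h x = 0) : Commute (ρ.g h) (ρ.g x) := by
  refine LinearMap.ext fun v => ?_
  simpa using ρ.commutator_of_par_eq_zero (c := 0) hpar (by simpa using hbr) v

section Predicates

variable {M : Type} [AddCommGroup M] [Module ℂ M] {b : Bool}

lemma mem_wtG {F : GAct m n b M} {lam : HIdx m b → ℂ} {v : M} :
    v ∈ wtG F lam ↔ ∀ h, F (hB m n b h) v = lam h • v := by
  simp [wtG, sub_eq_zero]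

lemma mem_wtFullG {F : GAct m n b M} {lam : HIdx m b → ℂ} {mu : Fin n → ℂ} {v : M} :
    v ∈ wtFullG F lam mu ↔
      (∀ h, F (hB m n b h) v = lam h • v) ∧ ∀ a, F (hppB m n b a) v = mu a • v := by
  rw [wtFullG, Submodule.mem_inf, mem_wtG]
  simp [sub_eq_zero]

end Predicates

/-- Finitely many commuting operators preserving a nonzero finite-dimensional subspace have a
common eigenvector in it. -/
lemma exists_common_eigenvector {ι K V : Type*} [Field K] [IsAlgClosed K] [AddCommGroup V]
    [Module K V] (f : ι → Module.End K V) (hf : ∀ i j, Commute (f i) (f j))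
    (U : Submodule K V) [FiniteDimensional K U] (hU : U ≠ ⊥)
    (hfU : ∀ i, ∀ v ∈ U, f i v ∈ U) (s : Finset ι) :
    ∃ mu : ι → K, ∃ v ∈ U, v ≠ 0 ∧ ∀ i ∈ s, f i v = mu i • v := by
  classical
  induction s using Finset.induction_on with
  | empty =>
    obtain ⟨v, hv, hv0⟩ := Submodule.exists_mem_ne_zero_of_ne_bot hU
    exact ⟨0, v, hv, hv0, by simp⟩
  | insert j s hj ih =>
    obtain ⟨mu, v, hvU, hv0, hv⟩ := ih
    let E : Submodule K V := U ⊓ ⨅ i ∈ s, LinearMap.ker (f i - mu i • LinearMap.id)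
    have mem_E (w : V) : w ∈ E ↔ w ∈ U ∧ ∀ i ∈ s, f i w = mu i • w := by
      simp [E, sub_eq_zero]
    have : FiniteDimensional K E := Submodule.finiteDimensional_of_le inf_le_left
    have : Nontrivial E :=
      ⟨⟨v, (mem_E v).2 ⟨hvU, hv⟩⟩, 0, fun h => hv0 (congrArg Subtype.val h)⟩
    have hE : ∀ w ∈ E, f j w ∈ E := by
      intro w hw
      obtain ⟨hwU, hw⟩ := (mem_E w).1 hw
      refine (mem_E _).2 ⟨hfU j w hwU, fun i hi => ?_⟩
      rw [← Module.End.mul_apply, (hf i j).eq, Module.End.mul_apply, hw i hi, map_smul]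
    obtain ⟨c, hc⟩ := Module.End.exists_eigenvalue ((f j).restrict hE)
    obtain ⟨w, hw⟩ := hc.exists_hasEigenvector
    have hwj : f j w = c • (w : V) := congrArg Subtype.val hw.apply_eq_smul
    obtain ⟨hwU, hws⟩ := (mem_E w).1 w.2
    refine ⟨Function.update mu j c, w, hwU, fun h => hw.2 (Subtype.ext h), fun i hi => ?_⟩
    rcases Finset.mem_insert.1 hi with rfl | hi
    · simpa using hwj
    · rw [Function.update_of_ne (ne_of_mem_of_not_mem hi hj), hws i hi]

lemma invariantG_iSup_wtFullG {b : Bool} (ρ : WRep m n b) :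
    InvariantG ρ.g (⨆ lam, ⨆ mu, wtFullG ρ.g lam mu) := by
  intro x
  choose c hc using fun h => exists_brB_hB_eq_smul (n := n) (b := b) h x
  choose e he using fun a => exists_brB_hppB_eq_smul a x
  change (⨆ lam, ⨆ mu, wtFullG ρ.g lam mu) ≤ (⨆ lam, ⨆ mu, wtFullG ρ.g lam mu).comap (ρ.g x)
  refine iSup₂_le fun lam mu v hv => ?_
  obtain ⟨hlam, hmu⟩ := mem_wtFullG.1 hv
  refine le_iSup₂ (f := fun lam mu => wtFullG ρ.g lam mu) (lam + c) (mu + e)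
    (mem_wtFullG.2 ⟨fun h => ?_, fun a => ?_⟩)
  · rw [ρ.commutator_of_par_eq_zero (par_hB h) (hc h), hlam, map_smul, Pi.add_apply, add_smul]
  · rw [ρ.commutator_of_par_eq_zero (par_hppB a) (he a), hmu, map_smul, Pi.add_apply, add_smul]

lemma iSup_wtFullG_ne_bot {b : Bool} (ρ : WRep m n b) [Nontrivial ρ.M]
    (hstrong : IsStrongHCG ρ.g) : (⨆ lam, ⨆ mu, wtFullG ρ.g lam mu) ≠ ⊥ := by
  obtain ⟨lam, hlam⟩ : ∃ lam, wtG ρ.g lam ≠ ⊥ := by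
    by_contra! h
    exact bot_ne_top (α := Submodule ℂ ρ.M) (by simpa [h] using hstrong.1)
  have := hstrong.2 lam
  obtain ⟨mu, v, hv, hv0, hmu⟩ := exists_common_eigenvector (fun a => ρ.g (hppB m n b a))
    (fun a c => ρ.commute_of_par_eq_zero (par_hppB a) (brB_hppB_hppB a c)) (wtG ρ.g lam) hlam
    (fun a v hv => mem_wtG.2 fun h => by
      have hcomm := ρ.commute_of_par_eq_zero (par_hppB a) (brB_hppB_hB a h)
      rw [← Module.End.mul_apply, ← hcomm.eq, Module.End.mul_apply, mem_wtG.1 hv h, map_smul])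
    Finset.univ
  refine (Submodule.ne_bot_iff _).2 ⟨v, ?_, hv0⟩
  exact le_iSup₂ (f := fun lam mu => wtFullG ρ.g lam mu) lam mu
    (mem_wtFullG.2 ⟨mem_wtG.1 hv, fun a => hmu a (Finset.mem_univ a)⟩)

end HelperLemmas

/-- Let `V` be one of the Lie superalgebras `W(m,n)`
(the case `b = false`), `W(m,n) ⋉ A d_0` (the case `b = true`), or `W(m+1,n)`
(the case `b = false` with `m` replaced by `m+1`), and suppose `M` is a simple
strong Harish-Chandra `V`-module.  Then the action of `h''` on `M` is
diagonalizable, and `M` is a Harish-Chandra module (it has a weight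
decomposition with respect to `h = h' ⊕ h''` with finite-dimensional weight
spaces). -/
theorem simple_strongHC_is_HC (m n : ℕ) (b : Bool) (ρ : WRep m n b)
    (hsimple : IsSimpleG ρ.g) (hstrong : IsStrongHCG ρ.g) :
    DiagHppG ρ.g ∧ IsHCG ρ.g := by
  obtain ⟨⟨v, hv⟩, hinv⟩ := hsimple
  have : Nontrivial ρ.M := ⟨v, 0, hv⟩
  have htop := (hinv _ (invariantG_iSup_wtFullG ρ)).resolve_left (iSup_wtFullG_ne_bot ρ hstrong)
  refine ⟨top_le_iff.1 (htop.ge.trans (iSup_le fun lam => iSup_mono fun mu => inf_le_right)),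
    htop, fun lam mu => ?_⟩
  have := hstrong.2 lam
  exact Submodule.finiteDimensional_of_le inf_le_left

end WSuper
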